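/- Let N ≥ 2 be an integer, g, h, u_m, α₂, …, α_N real numbers, and α₁ a nonzero real number. Then for every λ ∈ ℝ, det(A^{MHSWME} − λ·I_{N+2}) = ((−α₁)^N · N! / (2N+1)!!) · P'_{N+1}((λ − u_m)/α₁) · ((λ − u_m)² − gh − α₁² + Σ_{i=2}^N α_i²/(2i+1)). -/

import Mathlib

open Polynomial

/-- The Legendre polynomial of degree `n` (Rodrigues' formula), normalized so `P n 1 = 1`. -/
noncomputable def legendre (n : ℕ) : Polynomial ℝ :=
  ((2 ^ n * n.factorial : ℝ))⁻¹ • (derivative^[n] ((X ^ 2 - 1) ^ n))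

/-- Entry `(i,j)` (0-based) of the tridiagonal matrix `A₂`. -/
noncomputable def A2entry (α1 : ℝ) (i j : ℕ) : ℝ :=
  if j = i + 1 then ((i : ℝ) + 3) / (2 * (i : ℝ) + 5) * α1
  else if i = j + 1 then ((j : ℝ) + 1) / (2 * (j : ℝ) + 3) * α1
  else 0

/-- The MHSWME system matrix in convective variables. -/
noncomputable def AMHSWME (N : ℕ) (g h um : ℝ) (α : ℕ → ℝ) :
    Matrix (Fin (N + 2)) (Fin (N + 2)) ℝ := fun r c =>
  if r.val = 0 then (if c.val = 1 then 1 else 0)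
  else if r.val = 1 then
    (if c.val = 0 then g * h - um ^ 2 - ∑ j ∈ Finset.Icc 1 N, (α j) ^ 2 / (2 * (j : ℝ) + 1)
     else if c.val = 1 then 2 * um
     else 2 / (2 * (c.val : ℝ) - 1) * α (c.val - 1))
  else if c.val = 0 then
    (if r.val = 2 then -2 * um * α 1 else if r.val = 3 then -(2 / 3) * (α 1) ^ 2 else 0)
  else if c.val = 1 then (if r.val = 2 then 2 * α 1 else 0)
  else (if r = c then um else 0) + A2entry (α 1) (r.val - 2) (c.val - 2)

/-- A matrix vanishing outside its three central diagonals satisfies the continuant recurrence. -/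
theorem Matrix.det_tridiagonal_add_two {R : Type*} [CommRing R] (f : ℕ → ℕ → R)
    (hf : ∀ i j, i + 1 < j ∨ j + 1 < i → f i j = 0) (n : ℕ) :
    (Matrix.of fun i j : Fin (n + 2) => f i j).det =
      f (n + 1) (n + 1) * (Matrix.of fun i j : Fin (n + 1) => f i j).det -
        f (n + 1) n * f n (n + 1) * (Matrix.of fun i j : Fin n => f i j).det := by
  have hminor : ((Matrix.of fun i j : Fin (n + 2) => f i j).submatrix
      (Fin.last (n + 1)).succAbove (Fin.last n).castSucc.succAbove).det =
      f n (n + 1) * (Matrix.of fun i j : Fin n => f i j).det := by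
    rw [Matrix.det_succ_column _ (Fin.last n), Fin.sum_univ_castSucc, Finset.sum_eq_zero]
    · have hsub : (((Matrix.of fun i j : Fin (n + 2) => f i j).submatrix
          (Fin.last (n + 1)).succAbove (Fin.last n).castSucc.succAbove).submatrix
          (Fin.last n).succAbove (Fin.last n).succAbove) =
          Matrix.of fun i j : Fin n => f i j := by
        ext i j
        simp [Fin.succAbove, Fin.lt_def]
      rw [hsub]
      simp [Fin.succAbove, ← two_mul]
    · intro i _
      have : f i (n + 1) = 0 := hf _ _ (Or.inl (by omega))
      simp [Fin.succAbove, this]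
  rw [Matrix.det_succ_row _ (Fin.last (n + 1)), Fin.sum_univ_castSucc, Fin.sum_univ_castSucc,
    Finset.sum_eq_zero, hminor]
  · have hsub : ((Matrix.of fun i j : Fin (n + 2) => f i j).submatrix
        (Fin.last (n + 1)).succAbove (Fin.last (n + 1)).succAbove) =
        Matrix.of fun i j : Fin (n + 1) => f i j := by
      ext i j
      simp
    rw [hsub]
    have h1 : (-1 : R) ^ (n + 1 + n) = -1 := Odd.neg_one_pow ⟨n, by ring⟩
    simp [h1, ← two_mul]
    ring
  · intro j _
    have : f (n + 1) j = 0 := hf _ _ (Or.inr (by omega))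
    simp [this]

theorem derivative_legendre (n : ℕ) :
    derivative (legendre n) =
      C ((2 ^ n * n.factorial : ℝ))⁻¹ * derivative^[n + 1] ((X ^ 2 - 1) ^ n) := by
  rw [legendre, smul_eq_C_mul, derivative_C_mul, Function.iterate_succ_apply']

theorem derivative_legendre_succ (n : ℕ) :
    derivative (legendre (n + 1)) =
      X * derivative (legendre n) + C ((n : ℝ) + 1) * legendre n := by
  have h1 : derivative ((X ^ 2 - 1 : ℝ[X]) ^ (n + 1)) =
      C (2 * ((n : ℝ) + 1)) * (X * (X ^ 2 - 1) ^ n) := by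
    simp [derivative_pow]
    ring
  have hc : ((2 ^ (n + 1) * (n + 1).factorial : ℝ))⁻¹ * (2 * ((n : ℝ) + 1)) =
      ((2 ^ n * n.factorial : ℝ))⁻¹ := by
    have : (n.factorial : ℝ) ≠ 0 := by positivity
    rw [Nat.factorial_succ]
    push_cast
    field_simp
    ring
  rw [derivative_legendre, derivative_legendre, legendre, Function.iterate_succ_apply, h1,
    iterate_derivative_C_mul, ← mul_assoc, ← C_mul, hc, mul_comm X, iterate_derivative_mul_X,
    smul_eq_C_mul]
  simp
  ring

theorem derivative_legendre_add_two (n : ℕ) :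
    derivative (legendre (n + 2)) =
      derivative (legendre n) + C (2 * (n : ℝ) + 3) * legendre (n + 1) := by
  have h1 : derivative^[2] ((X ^ 2 - 1 : ℝ[X]) ^ (n + 2)) =
      C (2 * ((n : ℝ) + 2) * (2 * n + 3)) * (X ^ 2 - 1) ^ (n + 1) +
        C (2 * ((n : ℝ) + 2) * (2 * (n + 1))) * (X ^ 2 - 1) ^ n := by
    have hC2 : (C 2 : ℝ[X]) = 2 := map_ofNat C 2
    have hC3 : (C 3 : ℝ[X]) = 3 := map_ofNat C 3
    simp [derivative_pow, hC2, hC3]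
    ring
  have hn : (n.factorial : ℝ) ≠ 0 := by positivity
  have hc1 : ((2 ^ (n + 2) * (n + 2).factorial : ℝ))⁻¹ * (2 * ((n : ℝ) + 2) * (2 * n + 3)) =
      (2 * n + 3) * ((2 ^ (n + 1) * (n + 1).factorial : ℝ))⁻¹ := by
    rw [Nat.factorial_succ (n + 1)]
    push_cast
    have : ((n + 1).factorial : ℝ) ≠ 0 := by positivity
    field_simp
    ring
  have hc2 : ((2 ^ (n + 2) * (n + 2).factorial : ℝ))⁻¹ * (2 * ((n : ℝ) + 2) * (2 * (n + 1))) =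
      ((2 ^ n * n.factorial : ℝ))⁻¹ := by
    rw [Nat.factorial_succ (n + 1), Nat.factorial_succ n]
    push_cast
    field_simp
    ring
  rw [derivative_legendre, derivative_legendre, legendre, smul_eq_C_mul,
    Function.iterate_add_apply derivative (n + 1) 2, h1, iterate_map_add,
    iterate_derivative_C_mul, iterate_derivative_C_mul, mul_add, ← mul_assoc (C _), ← mul_assoc (C _),
    ← mul_assoc (C _), ← C_mul, ← C_mul, ← C_mul, hc1, hc2, add_comm]

theorem derivative_legendre_recurrence (n : ℕ) (x : ℝ) :
    ((n : ℝ) + 2) * (derivative (legendre (n + 3))).eval x =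
      (2 * (n : ℝ) + 5) * x * (derivative (legendre (n + 2))).eval x -
        ((n : ℝ) + 3) * (derivative (legendre (n + 1))).eval x := by
  have h1 := congrArg (eval x) (derivative_legendre_succ (n + 2))
  have h2 := congrArg (eval x) (derivative_legendre_add_two (n + 1))
  simp only [eval_add, eval_mul, eval_X, eval_C] at h1 h2
  push_cast at h1 h2
  linear_combination (2 * (n : ℝ) + 5) * h1 - ((n : ℝ) + 3) * h2

theorem det_A2_sub_smul_one (a x : ℝ) (ha : a ≠ 0) (n : ℕ) :
    (Matrix.of fun i j : Fin n =>
      (if (i : ℕ) = j then -x else 0) + A2entry a i j).det =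
      (-a) ^ n * (n.factorial : ℝ) / (Nat.doubleFactorial (2 * n + 1) : ℝ) *
        (derivative (legendre (n + 1))).eval (x / a) := by
  induction n using Nat.twoStepInduction with
  | zero =>
    simp [legendre]
    norm_num
  | one =>
    have h := derivative_legendre_add_two 0
    rw [h]
    simp [A2entry, legendre, Nat.doubleFactorial]
    field_simp
    norm_num
  | more n ih0 ih1 =>
    rw [Matrix.det_tridiagonal_add_two
      (fun i j => (if i = j then -x else 0) + A2entry a i j), ih0, ih1]
    · have hr := derivative_legendre_recurrence n (x / a)
      have h1 : (Nat.doubleFactorial (2 * (n + 1) + 1) : ℝ) =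
          (2 * n + 3) * Nat.doubleFactorial (2 * n + 1) := by
        rw [show 2 * (n + 1) + 1 = 2 * n + 1 + 2 by ring, Nat.doubleFactorial_add_two]
        push_cast
        ring
      have h2 : (Nat.doubleFactorial (2 * (n + 2) + 1) : ℝ) =
          (2 * n + 5) * ((2 * n + 3) * Nat.doubleFactorial (2 * n + 1)) := by
        rw [← h1, show 2 * (n + 2) + 1 = 2 * (n + 1) + 1 + 2 by ring,
          Nat.doubleFactorial_add_two]
        push_cast
        ring
      have hd : (Nat.doubleFactorial (2 * n + 1) : ℝ) ≠ 0 := by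
        exact_mod_cast (Nat.doubleFactorial_pos _).ne'
      rw [h1, h2, Nat.factorial_succ (n + 1), Nat.factorial_succ n]
      have h13 : n ≠ n + 1 + 1 := by omega
      simp [A2entry, h13]
      have h3 : (2 * n + 3 : ℝ) ≠ 0 := by positivity
      have h5 : (2 * n + 5 : ℝ) ≠ 0 := by positivity
      generalize eval (x / a) (derivative (legendre (n + 1))) = p at *
      generalize eval (x / a) (derivative (legendre (n + 1 + 1))) = q at *
      generalize eval (x / a) (derivative (legendre (n + 2 + 1))) = r at *
      rw [← sub_eq_zero]
      field_simp at hr ⊢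
      linear_combination -((n : ℝ) + 1) * n.factorial * (-a) ^ n * a * hr
    · intro i j hij
      have h1 : i ≠ j := by omega
      have h2 : j ≠ i + 1 := by omega
      have h3 : i ≠ j + 1 := by omega
      simp [A2entry, h1, h2, h3]

theorem AMHSWME_sub_mulVec (N : ℕ) (hN : 2 ≤ N) (g h um : ℝ) (α : ℕ → ℝ) (lam : ℝ) :
    (AMHSWME N g h um α - lam • (1 : Matrix (Fin (N + 2)) (Fin (N + 2)) ℝ)).mulVec
      (fun i => if i.val = 0 then 1 else if i.val = 1 then lam
        else if i.val = 2 then 2 * α 1 else 0) =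
      Pi.single 1 (-((lam - um) ^ 2 - g * h - (α 1) ^ 2 +
          ∑ i ∈ Finset.Icc 2 N, (α i) ^ 2 / (2 * (i : ℝ) + 1))) := by
  obtain ⟨m, rfl⟩ := Nat.exists_eq_add_of_le' hN
  have hs : ∑ j ∈ Finset.Icc 1 (m + 2), (α j) ^ 2 / (2 * (j : ℝ) + 1) =
      (α 1) ^ 2 / 3 + ∑ j ∈ Finset.Icc 2 (m + 2), (α j) ^ 2 / (2 * (j : ℝ) + 1) := by
    rw [← Finset.add_sum_Ioc_eq_sum_Icc (by omega)]
    norm_num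
    rfl
  have h2 : 2 % (m + 2 + 2) = 2 := Nat.mod_eq_of_lt (by omega)
  have h2' : 2 % (m + 3) = 2 := Nat.mod_eq_of_lt (by omega)
  ext i
  simp only [Matrix.mulVec, dotProduct, Fin.sum_univ_succ (n := m + 3),
    Fin.sum_univ_succ (n := m + 2), Fin.sum_univ_succ (n := m + 1)]
  rw [Finset.sum_eq_zero (by intro j _; simp)]
  refine Fin.cases ?_ (fun i => Fin.cases ?_ (fun i => Fin.cases ?_
    (fun i => Fin.cases ?_ (fun i => ?_) i) i) i) i
  all_goals
    simp [AMHSWME, A2entry, hs, h2, h2', Fin.ext_iff]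
  all_goals ring

/-- Characteristic polynomial of the MHSWME system matrix. -/
theorem stmt_5 (N : ℕ) (hN : 2 ≤ N) (g h um : ℝ) (α : ℕ → ℝ) (hα1 : α 1 ≠ 0) (lam : ℝ) :
    (AMHSWME N g h um α - lam • (1 : Matrix (Fin (N + 2)) (Fin (N + 2)) ℝ)).det =
      (-(α 1)) ^ N * (N.factorial : ℝ) / (Nat.doubleFactorial (2 * N + 1) : ℝ) *
        (derivative (legendre (N + 1))).eval ((lam - um) / α 1) *
        ((lam - um) ^ 2 - g * h - (α 1) ^ 2 +
          ∑ i ∈ Finset.Icc 2 N, (α i) ^ 2 / (2 * (i : ℝ) + 1)) := by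
  set M := AMHSWME N g h um α - lam • (1 : Matrix (Fin (N + 2)) (Fin (N + 2)) ℝ)
  set v : Fin (N + 2) → ℝ := fun i => if i.val = 0 then 1 else if i.val = 1 then lam
        else if i.val = 2 then 2 * α 1 else 0 with hv
  have hMv := AMHSWME_sub_mulVec N hN g h um α lam
  have hdet : M.det = (M.adjugate.mulVec (M.mulVec v)) 0 := by
    rw [Matrix.mulVec_mulVec, Matrix.adjugate_mul, Matrix.smul_mulVec, Matrix.one_mulVec]
    simp [hv]
  rw [hdet, hMv, Matrix.mulVec_single, Pi.smul_apply, Matrix.col_apply,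
    Matrix.adjugate_fin_succ_eq_det_submatrix]
  have hblock : (M.submatrix (Fin.succAbove 1) (Fin.succAbove 0)).det =
      (Matrix.of fun i j : Fin N =>
        (if (i : ℕ) = j then -(lam - um) else 0) + A2entry (α 1) i j).det := by
    rw [Matrix.det_succ_row_zero, Fin.sum_univ_succ, Finset.sum_eq_zero]
    · rw [add_zero]
      have hsub : (M.submatrix (Fin.succAbove 1) (Fin.succAbove 0)).submatrix Fin.succ
          (Fin.succAbove 0) = Matrix.of fun i j : Fin N =>
          (if (i : ℕ) = j then -(lam - um) else 0) + A2entry (α 1) i j := by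
        ext i j
        have : (1 : Fin (N + 2)).succAbove i.succ = i.succ.succ := by
          rw [← Fin.succ_zero_eq_one, Fin.succ_succAbove_succ, Fin.succAbove_zero]
        simp only [Matrix.submatrix_apply, this]
        by_cases hij : i = j
        · subst hij
          simp [M, AMHSWME]
          ring
        · simp [M, AMHSWME, hij, Fin.val_inj]
      rw [hsub]
      simp [M, AMHSWME]
    · intro j _
      simp [M, AMHSWME, Fin.ext_iff]
  rw [hblock, det_A2_sub_smul_one _ _ hα1]
  simp
  ring_nf
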